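/- The Schur multiplier H₂(A₅; ℤ) of the alternating group A₅ is isomorphic to ℤ/2. -/

import Mathlib

/-- The transfer of a central element lying in the commutator subgroup is trivial. -/
theorem pow_index_mem_commutator {G : Type*} [Group G] (H : Subgroup G) [H.FiniteIndex] {z : G}
    (hz : z ∈ Subgroup.center G) (hc : z ∈ commutator G) : z ^ H.index ∈ ⁅H, H⁆ := by
  have key : ∀ (k : ℕ) (g₀ : G), g₀⁻¹ * z ^ k * g₀ ∈ H → g₀⁻¹ * z ^ k * g₀ = z ^ k := by
    intro k g₀ _
    rw [mul_assoc, ← Subgroup.mem_center_iff.1 (pow_mem hz k) g₀, inv_mul_cancel_left]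
  have h1 := MonoidHom.transfer_eq_pow (Abelianization.of (G := H)) z key
  have h2 : MonoidHom.transfer (Abelianization.of (G := H)) z = 1 :=
    Abelianization.commutator_subset_ker _ hc
  rw [h2] at h1
  have h3 := (Abelianization.ker_of H).le (MonoidHom.mem_ker.2 h1.symm)
  rw [← Subgroup.map_subtype_commutator]
  exact ⟨_, h3, rfl⟩

theorem commutator_comap_eq_bot_of_isCyclic {G Q : Type*} [Group G] [Group Q] (p : G →* Q)
    (hp : p.ker ≤ Subgroup.center G) (K : Subgroup Q) [IsCyclic K] :
    ⁅K.comap p, K.comap p⁆ = ⊥ := by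
  rw [eq_bot_iff, Subgroup.commutator_le]
  intro g hg h hh
  rw [Subgroup.mem_bot, commutatorElement_eq_one_iff_mul_comm]
  have hker : (p.subgroupComap K).ker ≤ Subgroup.center (K.comap p) := fun x hx => by
    have hx' : (x : G) ∈ p.ker := congrArg Subtype.val (MonoidHom.mem_ker.1 hx)
    rw [Subgroup.mem_center_iff]
    exact fun y => Subtype.ext (Subgroup.mem_center_iff.1 (hp hx') y)
  have := MonoidHom.isMulCommutative_of_isCyclic_of_ker_le_center _ hker
  exact congrArg Subtype.val (mul_comm' (⟨g, hg⟩ : K.comap p) ⟨h, hh⟩)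

open scoped commutatorElement in
/-- A central extension of a Klein four-group has derived subgroup of order at most two. -/
theorem exists_commutator_comap_klein {G Q : Type*} [Group G] [Group Q] (p : G →* Q)
    (hs : Function.Surjective p) (hp : p.ker ≤ Subgroup.center G) (V : Subgroup Q) (a b : Q)
    (hab : a * b = b * a) (ha : a * a = 1)
    (hV : ∀ v ∈ V, v = 1 ∨ v = a ∨ v = b ∨ v = a * b) :
    ∃ t : G, ∀ z ∈ ⁅V.comap p, V.comap p⁆, z = 1 ∨ z = t := by
  obtain ⟨u, rfl⟩ := hs a
  obtain ⟨v, rfl⟩ := hs b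
  have ht : ⁅u, v⁆ ∈ Subgroup.center G := hp (by
    rw [MonoidHom.mem_ker, map_commutatorElement, commutatorElement_eq_one_iff_mul_comm, hab])
  have hu : u * u ∈ Subgroup.center G := hp (by rw [MonoidHom.mem_ker, map_mul, ha])
  have ht2 : ⁅u, v⁆ ^ 2 = 1 := by
    have h1 : ⁅u, v⁆ * (v * u) = u * v := by simp [commutatorElement_def, mul_assoc]
    have h2 := Subgroup.mem_center_iff.1 hu v
    have h3 := Subgroup.mem_center_iff.1 ht u
    have : ⁅u, v⁆ ^ 2 * (v * (u * u)) = v * (u * u) := by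
      calc ⁅u, v⁆ ^ 2 * (v * (u * u)) = ⁅u, v⁆ * (⁅u, v⁆ * (v * u)) * u := by
            simp only [pow_two, mul_assoc]
        _ = u * (⁅u, v⁆ * (v * u)) := by rw [h1, ← mul_assoc ⁅u, v⁆, ← h3]; simp only [mul_assoc, ← h1]
        _ = v * (u * u) := by rw [h1, h2, mul_assoc]
    exact mul_eq_right.1 this
  set N := Subgroup.zpowers ⁅u, v⁆ with hN
  have hNc : N ≤ Subgroup.center G := by rwa [hN, Subgroup.zpowers_le]
  have : N.Normal := ⟨fun n hn g => by
    rw [Subgroup.mem_center_iff.1 (hNc hn) g, mul_inv_cancel_right]; exact hn⟩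
  let q := QuotientGroup.mk' N
  have huv : Commute (q u) (q v) := by
    rw [← commutatorElement_eq_one_iff_commute, ← map_commutatorElement, ← MonoidHom.mem_ker,
      QuotientGroup.ker_mk']
    exact Subgroup.mem_zpowers _
  have step : ∀ x, Commute x (q u) → Commute x (q v) → ∀ g ∈ V.comap p, Commute x (q g) := by
    intro x hxu hxv g hg
    have main : ∀ w, Commute x (q w) → p g = p w → Commute x (q g) := by
      intro w hw h
      have hz : w⁻¹ * g ∈ Subgroup.center G := hp (by simp [MonoidHom.mem_ker, h])
      obtain ⟨y, rfl⟩ := QuotientGroup.mk'_surjective N x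
      have : Commute (q y) (q (w⁻¹ * g)) :=
        Commute.map (show Commute y (w⁻¹ * g) from Subgroup.mem_center_iff.1 hz y) q
      simpa [q] using hw.mul_right this
    rcases hV _ hg with h | h | h | h
    · exact main 1 (by simp) (by simpa using h)
    · exact main u hxu h
    · exact main v hxv h
    · exact main (u * v) (by rw [map_mul]; exact hxu.mul_right hxv) (by simpa using h)
  have hle : ⁅V.comap p, V.comap p⁆ ≤ N := by
    rw [Subgroup.commutator_le]
    intro g hg h hh
    rw [← QuotientGroup.ker_mk' N, MonoidHom.mem_ker, map_commutatorElement,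
      commutatorElement_eq_one_iff_commute]
    exact step _ (step _ (.refl _) huv g hg).symm (step _ huv.symm (.refl _) g hg).symm h hh
  refine ⟨⁅u, v⁆, fun z hz => ?_⟩
  obtain ⟨k, rfl⟩ := Subgroup.mem_zpowers_iff.1 (hle hz)
  rcases Int.even_or_odd' k with ⟨m, rfl | rfl⟩
  · left
    rw [zpow_mul, zpow_ofNat, ht2, one_zpow]
  · right
    rw [zpow_add_one, zpow_mul, zpow_ofNat, ht2, one_zpow, one_mul]

theorem card_alternatingGroup_five : Nat.card (alternatingGroup (Fin 5)) = 60 := by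
  rw [nat_card_alternatingGroup]; simp [Nat.factorial]

set_option maxRecDepth 10000 in
theorem exists_eq_one_or_eq_of_central_extension {G : Type*} [Group G]
    (p : G →* alternatingGroup (Fin 5)) (hs : Function.Surjective p)
    (hp : p.ker ≤ Subgroup.center G) :
    ∃ t : G, ∀ z ∈ p.ker ⊓ commutator G, z = 1 ∨ z = t := by
  let a : alternatingGroup (Fin 5) := ⟨Equiv.swap 0 1 * Equiv.swap 2 3, Equiv.Perm.mem_alternatingGroup.2 (by decide)⟩
  let b : alternatingGroup (Fin 5) := ⟨Equiv.swap 0 2 * Equiv.swap 1 3, Equiv.Perm.mem_alternatingGroup.2 (by decide)⟩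
  let c : alternatingGroup (Fin 5) := ⟨c[0, 1, 2], Equiv.Perm.mem_alternatingGroup.2 (by decide)⟩
  let d : alternatingGroup (Fin 5) := ⟨c[0, 1, 2, 3, 4], Equiv.Perm.mem_alternatingGroup.2 (by decide)⟩
  let V : Subgroup (alternatingGroup (Fin 5)) :=
    { carrier := SetLike.coe ({1, a, b, a * b} : Finset (alternatingGroup (Fin 5)))
      one_mem' := by decide
      mul_mem' := by
        have : ∀ x ∈ ({1, a, b, a * b} : Finset (alternatingGroup (Fin 5))),
          ∀ y ∈ ({1, a, b, a * b} : Finset (alternatingGroup (Fin 5))),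
          x * y ∈ ({1, a, b, a * b} : Finset (alternatingGroup (Fin 5))) := by decide
        exact fun {x y} hx hy => this x hx y hy
      inv_mem' := by
        have : ∀ x ∈ ({1, a, b, a * b} : Finset (alternatingGroup (Fin 5))),
          x⁻¹ ∈ ({1, a, b, a * b} : Finset (alternatingGroup (Fin 5))) := by decide
        exact fun {x} hx => this x hx }
  have hVcard : Nat.card V = 4 := by
    change Nat.card (SetLike.coe ({1, a, b, a * b} : Finset (alternatingGroup (Fin 5)))) = 4
    rw [Nat.card_coe_set_eq, Set.ncard_coe_finset]
    decide
  have hc : orderOf c = 3 := orderOf_eq_prime (by decide) (by decide)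
  have : Fact (Nat.Prime 5) := ⟨by norm_num⟩
  have hd : orderOf d = 5 := orderOf_eq_prime (by decide) (by decide)
  obtain ⟨t, ht⟩ := exists_commutator_comap_klein p hs hp V a b (by decide) (by decide)
    (fun v hv => by simpa using (show v ∈ ({1, a, b, a * b} : Finset _) from hv))
  have hindex : ∀ K : Subgroup (alternatingGroup (Fin 5)),
      (K.comap p).index * Nat.card K = 60 := fun K => by
    rw [Subgroup.index_comap_of_surjective _ hs, Subgroup.index_mul_card,
      card_alternatingGroup_five]
  have hmem : ∀ (K : Subgroup (alternatingGroup (Fin 5))) (n : ℕ), n * Nat.card K = 60 →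
      ∀ z ∈ p.ker ⊓ commutator G, z ^ n ∈ ⁅K.comap p, K.comap p⁆ := by
    intro K n hn z hz
    have hi : (K.comap p).index = n :=
      Nat.eq_of_mul_eq_mul_right Nat.card_pos ((hindex K).trans hn.symm)
    have : (K.comap p).FiniteIndex := ⟨by rintro h; have := hindex K; simp [h] at this⟩
    exact hi ▸ pow_index_mem_commutator (K.comap p) (hp hz.1) hz.2
  refine ⟨t, fun z hz => ?_⟩
  have h20 : z ^ 20 = 1 := by
    have := hmem (Subgroup.zpowers c) 20 (by rw [Nat.card_zpowers, hc]) z hz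
    rwa [commutator_comap_eq_bot_of_isCyclic p hp] at this
  have h12 : z ^ 12 = 1 := by
    have := hmem (Subgroup.zpowers d) 12 (by rw [Nat.card_zpowers, hd]) z hz
    rwa [commutator_comap_eq_bot_of_isCyclic p hp] at this
  have h4 : z ^ 4 = 1 := pow_gcd_eq_one.2 ⟨h20, h12⟩
  have h15 := hmem V 15 (by rw [hVcard]) z hz
  have hz15 : (z ^ 15)⁻¹ = z := by
    rw [inv_eq_iff_mul_eq_one, ← pow_succ, show 15 + 1 = 4 * 4 by rfl, pow_mul, h4, one_pow]
  exact ht z (hz15 ▸ inv_mem h15)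

/-- A sign-twisted lift of every permutation of anticommuting square roots of one to a unit of
the algebra they generate; membership in that algebra is expressed by the double centralizer. -/
theorem exists_unit_lift_perm {A ι : Type*} [Ring A] [Fintype ι] [DecidableEq ι]
    (e : ι → A) (two : Aˣ) (h2 : (two : A) = 2) (hsq : ∀ i, e i * e i = 1)
    (hanti : ∀ i j, i ≠ j → e i * e j = -(e j * e i)) (σ : Equiv.Perm ι) :
    ∃ g : Aˣ, (∀ x, (∀ i, Commute x (e i)) → Commute x (g : A)) ∧
      ∀ i, (g : A) * e i = ((Equiv.Perm.sign σ : ℤ) : A) * (e (σ i) * g) := by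
  induction σ using Equiv.Perm.swap_induction_on with
  | one => exact ⟨1, fun x _ => by simp, fun i => by simp⟩
  | swap_mul σ x y hxy ih =>
    obtain ⟨g, hg, hge⟩ := ih
    have hsq2 : (e x - e y) * (e x - e y) = two := by
      rw [h2, mul_sub, sub_mul, sub_mul, hsq, hsq, hanti x y hxy, ← one_add_one_eq_two]
      abel
    have hcomm : Commute ((two⁻¹ : Aˣ) : A) (e x - e y) := by
      apply Commute.units_inv_left
      rw [h2]
      exact Commute.ofNat_left 2 _
    let s : Aˣ := ⟨e x - e y, ((two⁻¹ : Aˣ) : A) * (e x - e y),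
      by rw [← mul_assoc, ← hcomm.eq, mul_assoc, hsq2, Units.inv_mul],
      by rw [mul_assoc, hsq2, Units.inv_mul]⟩
    have hse : ∀ i, (e x - e y) * e i = -(e (Equiv.swap x y i) * (e x - e y)) := by
      intro i
      rcases eq_or_ne i x with rfl | hix
      · rw [Equiv.swap_apply_left, sub_mul, mul_sub, hsq, hsq]; abel
      rcases eq_or_ne i y with rfl | hiy
      · rw [Equiv.swap_apply_right, sub_mul, mul_sub, hsq, hsq]; abel
      · rw [Equiv.swap_apply_of_ne_of_ne hix hiy, sub_mul, mul_sub, hanti i x hix, hanti i y hiy]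
        abel
    refine ⟨s * g, fun z hz => ?_, fun i => ?_⟩
    · exact ((hz x).sub_right (hz y)).mul_right (hg z hz)
    · have hcast := Int.cast_commute (Equiv.Perm.sign σ : ℤ) (e x - e y)
      change (e x - e y) * (g : A) * e i = _ * (_ * ((e x - e y) * (g : A)))
      rw [mul_assoc, hge, ← mul_assoc, ← hcast.eq, mul_assoc, ← mul_assoc _ _ (g : A), hse,
        Equiv.Perm.sign_mul, Equiv.Perm.sign_swap hxy]
      simp [mul_assoc]

/-- The group of pairs of a unit in the algebra generated by the `e i` and an even permutation
that the unit induces by conjugation. -/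
def cliffordCover {A ι : Type*} [Ring A] [Fintype ι] [DecidableEq ι] (e : ι → A) :
    Subgroup (Aˣ × alternatingGroup ι) where
  carrier := {w | (∀ x, (∀ i, Commute x (e i)) → Commute x (w.1 : A)) ∧
    ∀ i, (w.1 : A) * e i = e ((w.2 : Equiv.Perm ι) i) * w.1}
  one_mem' := ⟨fun x _ => by simp, fun i => by simp⟩
  mul_mem' {v w} hv hw := ⟨fun x hx => (hv.1 x hx).mul_right (hw.1 x hx), fun i => by
    simp only [Prod.fst_mul, Prod.snd_mul, Units.val_mul, Subgroup.coe_mul, Equiv.Perm.mul_apply]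
    rw [mul_assoc, hw.2, ← mul_assoc, hv.2, mul_assoc]⟩
  inv_mem' {w} hw := ⟨fun x hx => (hw.1 x hx).units_inv_right, fun i => by
    have := hw.2 ((w.2⁻¹ : alternatingGroup ι).1 i)
    simp only [Subgroup.coe_inv, Prod.fst_inv, Prod.snd_inv] at this ⊢
    rw [Units.inv_mul_eq_iff_eq_mul, ← mul_assoc, this, mul_assoc, Units.mul_inv, mul_one,
      Equiv.Perm.coe_inv, Equiv.apply_symm_apply]⟩

open scoped commutatorElement in
/-- There is a central extension of `A₅` whose kernel meets the derived subgroup nontrivially. -/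
theorem exists_central_extension_alternatingGroup_five :
    ∃ (G : Type) (_ : Group G) (p : G →* alternatingGroup (Fin 5)), Function.Surjective p ∧
      p.ker ≤ Subgroup.center G ∧ ∃ z ∈ p.ker ⊓ commutator G, z ≠ 1 := by
  let e : Fin 5 → Matrix (Fin 4) (Fin 4) (ZMod 5) :=
    ![!![0, 0, 0, 1; 0, 0, 1, 0; 0, 1, 0, 0; 1, 0, 0, 0],
      !![0, 0, 0, 3; 0, 0, 2, 0; 0, 3, 0, 0; 2, 0, 0, 0],
      !![0, 0, 1, 0; 0, 0, 0, 4; 1, 0, 0, 0; 0, 4, 0, 0],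
      !![0, 0, 3, 0; 0, 0, 0, 3; 2, 0, 0, 0; 0, 2, 0, 0],
      !![1, 0, 0, 0; 0, 1, 0, 0; 0, 0, 4, 0; 0, 0, 0, 4]]
  have hsq : ∀ i, e i * e i = 1 := by decide
  have hanti : ∀ i j, i ≠ j → e i * e j = -(e j * e i) := by decide
  let two : (Matrix (Fin 4) (Fin 4) (ZMod 5))ˣ := ⟨2, 3, by decide, by decide⟩
  let G := cliffordCover e
  let p : G →* alternatingGroup (Fin 5) := (MonoidHom.snd _ _).comp G.subtype
  have hs : Function.Surjective p := by
    intro σ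
    obtain ⟨g, hg, hge⟩ := exists_unit_lift_perm e two rfl hsq hanti σ
    refine ⟨⟨(g, σ), hg, fun i => ?_⟩, rfl⟩
    rw [hge, Equiv.Perm.mem_alternatingGroup.1 σ.2]
    simp
  refine ⟨G, inferInstance, p, hs, ?_, ?_⟩
  · rintro ⟨⟨g, σ⟩, hg⟩ (h : σ = 1)
    subst h
    rw [Subgroup.mem_center_iff]
    rintro ⟨⟨k, τ⟩, hk⟩
    refine Subtype.ext (Prod.ext (Units.ext (hk.1 g fun i => ?_).eq.symm) ?_)
    · exact (hg.2 i : g * e i = e i * g)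
    · simp
  · let u : (Matrix (Fin 4) (Fin 4) (ZMod 5))ˣ :=
      ⟨(e 0 - e 1) * (e 2 - e 3), (e 0 - e 1) * (e 2 - e 3), by decide, by decide⟩
    let v : (Matrix (Fin 4) (Fin 4) (ZMod 5))ˣ :=
      ⟨(e 0 - e 2) * (e 1 - e 3), (e 0 - e 2) * (e 1 - e 3), by decide, by decide⟩
    let a : alternatingGroup (Fin 5) :=
      ⟨Equiv.swap 0 1 * Equiv.swap 2 3, Equiv.Perm.mem_alternatingGroup.2 (by decide)⟩
    let b : alternatingGroup (Fin 5) :=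
      ⟨Equiv.swap 0 2 * Equiv.swap 1 3, Equiv.Perm.mem_alternatingGroup.2 (by decide)⟩
    have hu : (u, a) ∈ G := ⟨fun x hx =>
      ((hx 0).sub_right (hx 1)).mul_right ((hx 2).sub_right (hx 3)), by decide⟩
    have hv : (v, b) ∈ G := ⟨fun x hx =>
      ((hx 0).sub_right (hx 2)).mul_right ((hx 1).sub_right (hx 3)), by decide⟩
    refine ⟨⁅(⟨_, hu⟩ : G), ⟨_, hv⟩⁆, ⟨?_, ?_⟩, ?_⟩
    · refine MonoidHom.mem_ker.2 ?_
      rw [map_commutatorElement, commutatorElement_eq_one_iff_mul_comm]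
      exact (by decide : a * b = b * a)
    · exact Subgroup.commutator_mem_commutator (Subgroup.mem_top _) (Subgroup.mem_top _)
    · rw [Ne, commutatorElement_eq_one_iff_mul_comm]
      intro h
      have huv : (u : Matrix (Fin 4) (Fin 4) (ZMod 5)) * v = v * u :=
        congrArg (fun w : G => (w.1.1 : Matrix (Fin 4) (Fin 4) (ZMod 5))) h
      exact absurd huv (by decide)

open scoped commutatorElement in
/-- A subgroup that together with central elements exhausts the group has the full derived
subgroup. -/
theorem commutator_eq_of_forall_exists_mul_center {G : Type*} [Group G] (H : Subgroup G)
    (hH : ∀ g, ∃ h ∈ H, ∃ z ∈ Subgroup.center G, g = h * z) : ⁅H, H⁆ = commutator G := by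
  refine le_antisymm (Subgroup.commutator_mono le_top le_top) ?_
  rw [commutator_def, Subgroup.commutator_le]
  intro g _ k _
  obtain ⟨h, hh, z, hz, rfl⟩ := hH g
  obtain ⟨l, hl, w, hw, rfl⟩ := hH k
  have key : ⁅h * z, l * w⁆ = ⁅h, l⁆ := by
    have conj : ∀ c ∈ Subgroup.center G, ∀ x, c * x * c⁻¹ = x := fun c hc x => by
      rw [← Subgroup.mem_center_iff.1 hc x, mul_inv_cancel_right]
    calc ⁅h * z, l * w⁆ = h * (z * (l * w) * z⁻¹) * h⁻¹ * (l * w)⁻¹ := by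
          rw [commutatorElement_def]; group
      _ = h * l * (w * h⁻¹ * w⁻¹) * l⁻¹ := by rw [conj z hz]; group
      _ = ⁅h, l⁆ := by rw [conj w hw, commutatorElement_def]
  rw [key]
  exact Subgroup.commutator_mem_commutator hh hl

theorem stmt9 {α : Type*} (π : FreeGroup α →* alternatingGroup (Fin 5))
    (hπ : Function.Surjective π) :
    Nonempty
      ((↥(π.ker ⊓ ⁅(⊤ : Subgroup (FreeGroup α)), (⊤ : Subgroup (FreeGroup α))⁆) ⧸
          (⁅(⊤ : Subgroup (FreeGroup α)), π.ker⁆).subgroupOf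
            (π.ker ⊓ ⁅(⊤ : Subgroup (FreeGroup α)), (⊤ : Subgroup (FreeGroup α))⁆))
        ≃* Multiplicative (ZMod 2)) := by
  set N := ⁅(⊤ : Subgroup (FreeGroup α)), π.ker⁆ with hN
  have hNR : N ≤ π.ker := Subgroup.commutator_le_right _ _
  set K := π.ker ⊓ ⁅(⊤ : Subgroup (FreeGroup α)), (⊤ : Subgroup (FreeGroup α))⁆ with hK
  obtain ⟨t, ht⟩ : ∃ t : FreeGroup α ⧸ N, ∀ z ∈ K, (z : FreeGroup α ⧸ N) = 1 ∨ ↑z = t := by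
    let p := QuotientGroup.lift N π hNR
    obtain ⟨t, ht⟩ := exists_eq_one_or_eq_of_central_extension p
      (QuotientGroup.lift_surjective_of_surjective N π hπ hNR) (by
        intro x
        induction x using QuotientGroup.induction_on with | _ x =>
        intro (hx : x ∈ π.ker)
        rw [Subgroup.mem_center_iff]
        intro y
        induction y using QuotientGroup.induction_on with | _ y =>
        rw [← commutatorElement_eq_one_iff_mul_comm, ← QuotientGroup.mk'_apply,
          ← QuotientGroup.mk'_apply, ← map_commutatorElement, ← MonoidHom.mem_ker,
          QuotientGroup.ker_mk']
        exact Subgroup.commutator_mem_commutator (Subgroup.mem_top _) hx)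
    refine ⟨t, fun z hz => ht z ⟨hz.1, ?_⟩⟩
    have h : QuotientGroup.mk' N z ∈ _ := Subgroup.mem_map_of_mem (QuotientGroup.mk' N) hz.2
    rw [Subgroup.map_commutator] at h
    exact Subgroup.commutator_mono le_top le_top h
  obtain ⟨x, hxK, hxN⟩ : ∃ x ∈ K, x ∉ N := by
    obtain ⟨G, _, p, hs, hp, z, hz, hz1⟩ := exists_central_extension_alternatingGroup_five
    choose s hs using hs
    let f : FreeGroup α →* G := FreeGroup.lift fun i => s (π (FreeGroup.of i))
    have hf : ∀ x, p (f x) = π x := fun x =>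
      DFunLike.congr_fun (FreeGroup.ext_hom (p.comp f) π (by simp [f, hs])) x
    have hc : ⁅f.range, f.range⁆ = commutator G := by
      refine commutator_eq_of_forall_exists_mul_center _ fun g => ?_
      obtain ⟨y, hy⟩ := hπ (p g)
      exact ⟨f y, ⟨y, rfl⟩, (f y)⁻¹ * g, hp (by simp [MonoidHom.mem_ker, hf, hy]), by simp⟩
    obtain ⟨hzp, hzc⟩ := hz
    rw [SetLike.mem_coe, ← hc, MonoidHom.range_eq_map, ← Subgroup.map_commutator] at hzc
    obtain ⟨x, hx, rfl⟩ := hzc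
    refine ⟨x, ⟨(hf x).symm.trans hzp, hx⟩, fun hxN => hz1 ?_⟩
    have hle : N ≤ f.ker := by
      rw [hN, Subgroup.commutator_le]
      intro g _ r hr
      rw [MonoidHom.mem_ker, map_commutatorElement, commutatorElement_eq_one_iff_mul_comm]
      exact Subgroup.mem_center_iff.1 (hp ((hf r).trans hr)) _
    exact hle hxN
  have h1 : ∀ z : K, (z : K ⧸ N.subgroupOf K) = 1 ↔ ((z : FreeGroup α) : FreeGroup α ⧸ N) = 1 :=
    fun z => by rw [QuotientGroup.eq_one_iff, QuotientGroup.eq_one_iff, Subgroup.mem_subgroupOf]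
  have hx1 : ((⟨x, hxK⟩ : K) : K ⧸ N.subgroupOf K) ≠ 1 := by
    rwa [Ne, h1, QuotientGroup.eq_one_iff]
  have hcard : Nat.card (K ⧸ N.subgroupOf K) = 2 := by
    refine (Nat.card_eq_two_iff' 1).2 ⟨_, hx1, fun y hy => ?_⟩
    induction y using QuotientGroup.induction_on with | _ y =>
    have e1 := (ht y y.2).resolve_left ((h1 y).not.1 hy)
    have e2 := (ht x hxK).resolve_left ((h1 ⟨x, hxK⟩).not.1 hx1)
    exact QuotientGroup.eq.2 (Subgroup.mem_subgroupOf.2 (QuotientGroup.eq.1 (e1.trans e2.symm)))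
  have : Fact (Nat.Prime 2) := ⟨Nat.prime_two⟩
  exact ⟨mulEquivOfPrimeCardEq hcard (by simp)⟩
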